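/- arXiv:0711.2191 — 2 statements merged into one kernel-verified Lean document; each statement's English description precedes it below -/
import Mathlib

section
/- Let a ∈ ℝ^d have positive components and let r : [0,∞) → ℝ^d be continuous. Suppose b : [0,∞) → ℝ is absolutely continuous with b(0) = 0 and, for almost every t, b'(t) = ⟨r(t), a⟩ if ⟨r(t), a⟩ > 0 or b(t) > 0, and b'(t) = 0 otherwise. Then for every t ≥ 0, b(t) = sup_{0 ≤ s ≤ t} ∫_s^t ⟨r(w), a⟩ dw. -/
open MeasureTheory Set
open scoped RealInnerProductSpace

noncomputable section

/-- A continuous function that is nonpositive at the left endpoint of an interval has a last time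
at which it is nonpositive. -/
theorem exists_last_nonpos {g : ℝ → ℝ} {x t : ℝ} (hxt : x ≤ t) (hg : ContinuousOn g (Icc x t))
    (hgx : g x ≤ 0) : ∃ τ ∈ Icc x t, g τ ≤ 0 ∧ ∀ s ∈ Ioc τ t, 0 < g s := by
  have hclosed : IsClosed (Icc x t ∩ g ⁻¹' Iic 0) := hg.preimage_isClosed_of_isClosed
    isClosed_Icc isClosed_Iic
  obtain ⟨τ, ⟨hτ, hgτ⟩, hmax⟩ := (isCompact_Icc.of_isClosed_subset hclosed
    inter_subset_left).exists_isGreatest ⟨x, left_mem_Icc.2 hxt, hgx⟩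
  refine ⟨τ, hτ, hgτ, fun s hs => ?_⟩
  by_contra! h
  exact absurd (hmax ⟨⟨hτ.1.trans hs.1.le, hs.2⟩, h⟩) (not_le.2 hs.1)

/-- **Lemma 2 (the buffer is a running supremum)**: if `b` is an absolutely
continuous solution of the buffer equation driven by the rate `⟨r(t), a⟩`,
starting empty, then `b(t) = sup_{0 ≤ s ≤ t} ∫_s^t ⟨r(w), a⟩ dw`. -/
theorem buffer_eq_sup_integral {d : ℕ} (a : EuclideanSpace ℝ (Fin d))
    (ha : ∀ i, 0 < a i)
    (r : ℝ → EuclideanSpace ℝ (Fin d)) (hr : Continuous r)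
    (b b' : ℝ → ℝ) (hb0 : b 0 = 0)
    -- b is absolutely continuous with (a.e.) derivative b'
    (hb'int : ∀ t : ℝ, MeasureTheory.IntegrableOn b' (Set.Icc 0 t))
    (hbAC : ∀ t ≥ (0 : ℝ), b t = ∫ s in (0 : ℝ)..t, b' s)
    -- the buffer differential equation, holding almost everywhere
    (hODE : ∀ᵐ t ∂(MeasureTheory.volume.restrict (Set.Ioi (0 : ℝ))),
      b' t = if 0 < ⟪r t, a⟫ ∨ 0 < b t then ⟪r t, a⟫ else 0) :
    ∀ t ≥ (0 : ℝ),
      b t = sSup ((fun s => ∫ w in s..t, ⟪r w, a⟫) '' Set.Icc (0 : ℝ) t) := by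
  have hf : Continuous fun w => ⟪r w, a⟫ := hr.inner continuous_const
  have hfi (s t : ℝ) : IntervalIntegrable (fun w => ⟪r w, a⟫) volume s t :=
    hf.intervalIntegrable s t
  have hbi {s t : ℝ} (hs : 0 ≤ s) (hst : s ≤ t) : IntervalIntegrable b' volume s t :=
    (intervalIntegrable_iff_integrableOn_Icc_of_le hst).2
      ((hb'int t).mono_set (Icc_subset_Icc_left hs))
  have hsub {s t : ℝ} (hs : 0 ≤ s) (hst : s ≤ t) : b t - b s = ∫ w in s..t, b' w := by
    rw [hbAC t (hs.trans hst), hbAC s hs, intervalIntegral.integral_interval_sub_left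
      (hbi le_rfl (hs.trans hst)) (hbi le_rfl hs)]
  have hcont (t : ℝ) (ht : 0 ≤ t) : ContinuousOn b (Icc 0 t) := by
    have hbt := hb'int t
    rw [← uIcc_of_le ht] at hbt
    have h := intervalIntegral.continuousOn_primitive_interval hbt
    rw [uIcc_of_le ht] at h
    exact h.congr fun s hs => hbAC s hs.1
  have hODE' {s : ℝ} (t : ℝ) (hs : 0 ≤ s) : ∀ᵐ w ∂(volume.restrict (Ioc s t)),
      b' w = if 0 < ⟪r w, a⟫ ∨ 0 < b w then ⟪r w, a⟫ else 0 :=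
    ae_restrict_of_ae_restrict_of_subset (fun w hw => hs.trans_lt hw.1) hODE
  have hlower {s t : ℝ} (hs : 0 ≤ s) (hst : s ≤ t) : ∫ w in s..t, ⟪r w, a⟫ ≤ b t - b s := by
    rw [hsub hs hst, intervalIntegral.integral_of_le hst, intervalIntegral.integral_of_le hst]
    refine integral_mono_ae (hfi s t).1 (hbi hs hst).1 ?_
    filter_upwards [hODE' t hs] with w hw
    rw [hw]
    split_ifs with h
    · exact le_rfl
    · push Not at h
      exact h.1
  have hnonneg (t : ℝ) (ht : 0 ≤ t) : 0 ≤ b t := by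
    obtain ⟨τ, hτ, hbτ, hlast⟩ := exists_last_nonpos (g := fun s => -b s) ht (hcont t ht).neg
      (by simp [hb0])
    have hincr : 0 ≤ b t - b τ := by
      rw [hsub hτ.1 hτ.2, intervalIntegral.integral_of_le hτ.2]
      refine integral_nonneg_of_ae ?_
      filter_upwards [hODE' t hτ.1, ae_restrict_mem measurableSet_Ioc] with w hw hmem
      have hneg := hlast w hmem
      rw [hw]
      split_ifs with h
      · exact (h.resolve_right (by linarith)).le
      · exact le_rfl
    linarith
  intro t ht
  refine (IsGreatest.csSup_eq ⟨?_, ?_⟩).symm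
  · obtain ⟨τ, hτ, hbτ, hlast⟩ := exists_last_nonpos ht (hcont t ht) hb0.le
    refine ⟨τ, hτ, ?_⟩
    have heq : ∫ w in τ..t, b' w = ∫ w in τ..t, ⟪r w, a⟫ := by
      rw [intervalIntegral.integral_of_le hτ.2, intervalIntegral.integral_of_le hτ.2]
      refine integral_congr_ae ?_
      filter_upwards [hODE' t hτ.1, ae_restrict_mem measurableSet_Ioc] with w hw hmem
      rw [hw, if_pos (Or.inr (hlast w hmem))]
    have := hsub hτ.1 hτ.2
    have := hnonneg τ hτ.1
    change ∫ w in τ..t, ⟪r w, a⟫ = b t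
    linarith
  · rintro _ ⟨s, hs, rfl⟩
    have := hlower hs.1 hs.2
    have := hnonneg s hs.1
    change ∫ w in s..t, ⟪r w, a⟫ ≤ b t
    linarith
end
end

section
/- Let ℓ : ℝ^d → ℝ be strictly convex. For absolutely continuous paths r, z : [0,T] → ℝ^d and any γ ∈ (0,1), the action functional satisfies I_{[0,T]}(γr + (1−γ)z) ≤ γ I_{[0,T]}(r) + (1−γ) I_{[0,T]}(z), and the inequality is strict unless r(t) − r(0) = z(t) − z(0) for all t ∈ [0,T] (in particular, strict unless r ≡ z when r(0) = z(0)). -/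
open MeasureTheory Set

noncomputable section

/-- An absolutely continuous path on `[0,T]`, given with its integrable
(a.e.) derivative. -/
def IsPath {d : ℕ} (r r' : ℝ → EuclideanSpace ℝ (Fin d)) (T : ℝ) : Prop :=
  MeasureTheory.IntegrableOn r' (Set.Icc 0 T) ∧
    ∀ t ∈ Set.Icc (0 : ℝ) T, r t = r 0 + ∫ s in (0 : ℝ)..t, r' s

/-- The action functional `I_{[0,T]}(r) = ∫_0^T ℓ(r'(t)) dt`. -/
def cost {d : ℕ} (ℓ : EuclideanSpace ℝ (Fin d) → ℝ)
    (r' : ℝ → EuclideanSpace ℝ (Fin d)) (T : ℝ) : ℝ :=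
  ∫ t in (0 : ℝ)..T, ℓ (r' t)

section ConvexIntegral

variable {α E : Type*} {mα : MeasurableSpace α} {μ : Measure α} [IsFiniteMeasure μ]
  [NormedAddCommGroup E] [NormedSpace ℝ E] [FiniteDimensional ℝ E]
  {φ : E → ℝ} {f g : α → E} {γ : ℝ}

theorem ConvexOn.exists_affine_le (hφ : ConvexOn ℝ univ φ) :
    ∃ (L : E →L[ℝ] ℝ) (c : ℝ), ∀ x, L x + c ≤ φ x := by
  obtain ⟨L, c, h, -⟩ := hφ.exists_affine_le_of_lt (𝕜 := ℝ) (mem_univ 0) (sub_one_lt (φ 0))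
    isClosed_univ (hφ.locallyLipschitz.continuous.lowerSemicontinuous.lowerSemicontinuousOn _)
  exact ⟨L, c, fun x => by simpa using h ⟨x, mem_univ x⟩⟩

theorem ConvexOn.integrable_comp_combination (hφ : ConvexOn ℝ univ φ)
    (hf : Integrable f μ) (hg : Integrable g μ)
    (hφf : Integrable (fun t => φ (f t)) μ) (hφg : Integrable (fun t => φ (g t)) μ)
    (hγ : γ ∈ Ioo (0 : ℝ) 1) :
    Integrable (fun t => φ (γ • f t + (1 - γ) • g t)) μ := by
  obtain ⟨L, c, hL⟩ := hφ.exists_affine_le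
  have hfg : Integrable (fun t => γ • f t + (1 - γ) • g t) μ :=
    (hf.smul γ).add (hg.smul (1 - γ))
  refine integrable_of_le_of_le
    (hφ.locallyLipschitz.continuous.comp_aestronglyMeasurable hfg.aestronglyMeasurable)
    (ae_of_all _ fun t => hL (γ • f t + (1 - γ) • g t))
    (ae_of_all _ fun t => hφ.2 (mem_univ (f t)) (mem_univ (g t)) hγ.1.le
      (sub_nonneg.2 hγ.2.le) (add_sub_cancel γ 1))
    ((L.integrable_comp hfg).add (integrable_const c))
    ((hφf.smul γ).add (hφg.smul (1 - γ)))

theorem ConvexOn.integral_comp_combination_le (hφ : ConvexOn ℝ univ φ)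
    (hf : Integrable f μ) (hg : Integrable g μ)
    (hφf : Integrable (fun t => φ (f t)) μ) (hφg : Integrable (fun t => φ (g t)) μ)
    (hγ : γ ∈ Ioo (0 : ℝ) 1) :
    ∫ t, φ (γ • f t + (1 - γ) • g t) ∂μ ≤
      γ * ∫ t, φ (f t) ∂μ + (1 - γ) * ∫ t, φ (g t) ∂μ := by
  rw [← integral_const_mul, ← integral_const_mul,
    ← integral_add (hφf.const_mul γ) (hφg.const_mul (1 - γ))]
  exact integral_mono (hφ.integrable_comp_combination hf hg hφf hφg hγ)
    ((hφf.const_mul γ).add (hφg.const_mul (1 - γ)))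
    fun t => hφ.2 (mem_univ (f t)) (mem_univ (g t)) hγ.1.le
      (sub_nonneg.2 hγ.2.le) (add_sub_cancel γ 1)

theorem StrictConvexOn.ae_eq_of_integral_comp_combination_eq (hφ : StrictConvexOn ℝ univ φ)
    (hf : Integrable f μ) (hg : Integrable g μ)
    (hφf : Integrable (fun t => φ (f t)) μ) (hφg : Integrable (fun t => φ (g t)) μ)
    (hγ : γ ∈ Ioo (0 : ℝ) 1)
    (h : ∫ t, φ (γ • f t + (1 - γ) • g t) ∂μ =
      γ * ∫ t, φ (f t) ∂μ + (1 - γ) * ∫ t, φ (g t) ∂μ) :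
    f =ᵐ[μ] g := by
  rw [← integral_const_mul, ← integral_const_mul,
    ← integral_add (hφf.const_mul γ) (hφg.const_mul (1 - γ))] at h
  have hae := (integral_eq_iff_of_ae_le
    (hφ.convexOn.integrable_comp_combination hf hg hφf hφg hγ)
    ((hφf.const_mul γ).add (hφg.const_mul (1 - γ)))
    (ae_of_all _ fun t => hφ.convexOn.2 (mem_univ (f t)) (mem_univ (g t)) hγ.1.le
      (sub_nonneg.2 hγ.2.le) (add_sub_cancel γ 1))).1 h
  filter_upwards [hae] with t ht
  by_contra hne
  exact (hφ.2 (mem_univ (f t)) (mem_univ (g t)) hne hγ.1 (sub_pos.2 hγ.2)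
    (add_sub_cancel γ 1)).ne ht

end ConvexIntegral

/-- **Convexity of the action functional** (equation (8) of the paper): for
strictly convex `ℓ`, `I_{[0,T]}(γr + (1−γ)z) ≤ γ I_{[0,T]}(r) + (1−γ) I_{[0,T]}(z)`,
with strict inequality unless the increments of `r` and `z` agree. -/
theorem action_convexity {d : ℕ}
    (ℓ : EuclideanSpace ℝ (Fin d) → ℝ) (hℓ : StrictConvexOn ℝ Set.univ ℓ)
    (T : ℝ) (hT : 0 < T)
    (r r' z z' : ℝ → EuclideanSpace ℝ (Fin d))
    (hr : IsPath r r' T) (hz : IsPath z z' T)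
    (hr_int : IntervalIntegrable (fun t => ℓ (r' t)) MeasureTheory.volume 0 T)
    (hz_int : IntervalIntegrable (fun t => ℓ (z' t)) MeasureTheory.volume 0 T)
    (γ : ℝ) (hγ : γ ∈ Set.Ioo (0 : ℝ) 1) :
    cost ℓ (fun t => γ • r' t + (1 - γ) • z' t) T
        ≤ γ * cost ℓ r' T + (1 - γ) * cost ℓ z' T ∧
      ((¬ ∀ t ∈ Set.Icc (0 : ℝ) T, r t - r 0 = z t - z 0) →
        cost ℓ (fun t => γ • r' t + (1 - γ) • z' t) T
          < γ * cost ℓ r' T + (1 - γ) * cost ℓ z' T) := by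
  have hr' : IntegrableOn r' (Ioc 0 T) := hr.1.mono_set Ioc_subset_Icc_self
  have hz' : IntegrableOn z' (Ioc 0 T) := hz.1.mono_set Ioc_subset_Icc_self
  have hℓr := (intervalIntegrable_iff_integrableOn_Ioc_of_le hT.le).1 hr_int
  have hℓz := (intervalIntegrable_iff_integrableOn_Ioc_of_le hT.le).1 hz_int
  simp only [cost, intervalIntegral.integral_of_le hT.le]
  have hle := hℓ.convexOn.integral_comp_combination_le hr' hz' hℓr hℓz hγ
  refine ⟨hle, fun hne => hle.lt_of_ne fun heq => hne fun t ht => ?_⟩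
  have hae := hℓ.ae_eq_of_integral_comp_combination_eq hr' hz' hℓr hℓz hγ heq
  rw [hr.2 t ht, hz.2 t ht, add_sub_cancel_left, add_sub_cancel_left,
    intervalIntegral.integral_of_le ht.1, intervalIntegral.integral_of_le ht.1]
  exact integral_congr_ae (ae_restrict_of_ae_restrict_of_subset (Ioc_subset_Ioc_right ht.2) hae)
end
end
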